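/- Let S be a 3-dimensional Cohen–Macaulay Noetherian local ring with infinite residue field and let x, y, z be a system of parameters for S. Set R = S/(x² − yz)S and I = (x, y)R. Then j(I) = length_S(S/(x, y, z)S). -/

import Mathlib

open Filter

noncomputable section

/-- The length of a module, as the height of `⊤` in the submodule lattice. -/
def mLength (R M : Type*) [CommRing R] [AddCommGroup M] [Module R M] : ℕ∞ :=
  Order.height (⊤ : Submodule R M)

/-- The Krull dimension of a module, via the annihilator. -/
def mDim (R M : Type*) [CommRing R] [AddCommGroup M] [Module R M] : WithBot ℕ∞ :=
  ringKrullDim (R ⧸ Module.annihilator R M)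

/-- `H⁰_I(N)`: elements killed by a power of `I` (0-th local cohomology). -/
def H0 {R : Type*} [CommRing R] (I : Ideal R) (N : Type*) [AddCommGroup N] [Module R N] :
    Submodule R N :=
  ⨆ n : ℕ, Submodule.torsionBySet R N ((I ^ n : Ideal R) : Set R)

/-- `IⁿM/I^{n+1}M`, as a submodule of `M/I^{n+1}M`. -/
def gradedPiece {R : Type*} [CommRing R] (I : Ideal R) {M : Type*} [AddCommGroup M]
    [Module R M] (n : ℕ) : Submodule R (M ⧸ (I ^ (n + 1) • ⊤ : Submodule R M)) :=
  Submodule.map (I ^ (n + 1) • ⊤ : Submodule R M).mkQ (I ^ n • ⊤ : Submodule R M)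

/-- The `j`-multiplicity `j_d(I, M)`, defined as
`lim_n (d−1)!/n^(d−1) · length_R (H⁰_𝔪(IⁿM/I^{n+1}M))`. -/
def jMult {R : Type*} [CommRing R] (𝔪 I : Ideal R) (M : Type*) [AddCommGroup M]
    [Module R M] (d : ℕ) : ℝ :=
  limUnder atTop fun n : ℕ =>
    ((d - 1).factorial : ℝ) / (n : ℝ) ^ (d - 1) *
      ((mLength R (H0 𝔪 (gradedPiece I (M := M) n))).toNat : ℝ)

/-- The Hilbert–Samuel multiplicity `e(I; N)` of a `d`-dimensional module `N`
(equal to `0` if `N = 0`), defined as `lim_n d!/n^d · length_R (N/IⁿN)`. -/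
def hsMult {R : Type*} [CommRing R] (I : Ideal R) (N : Type*) [AddCommGroup N]
    [Module R N] (d : ℕ) : ℝ :=
  limUnder atTop fun n : ℕ =>
    (d.factorial : ℝ) / (n : ℝ) ^ d *
      ((mLength R (N ⧸ (I ^ n • ⊤ : Submodule R N))).toNat : ℝ)

/-- `K :_M I^∞ = ⋃ₙ (K :_M Iⁿ)`. -/
def satur {R : Type*} [CommRing R] (I : Ideal R) {M : Type*} [AddCommGroup M] [Module R M]
    (K : Submodule R M) : Submodule R M :=
  Submodule.comap K.mkQ (H0 I (M ⧸ K))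

/-- "For general elements `a₁, …, aᵢ` of `I`", i.e. for all `i`-tuples of elements of `I`
whose coefficient vectors with respect to any finite generating set of `I` avoid the zero
locus of some nonzero polynomial over the residue field `R/𝔪` (equivalently, whose images
lie in a suitable nonempty Zariski-open set of choices modulo `𝔪I`), property `P` holds. -/
def GeneralElts {R : Type*} [CommRing R] (𝔪 I : Ideal R) (i : ℕ)
    (P : (Fin i → R) → Prop) : Prop :=
  ∀ (m : ℕ) (x : Fin m → R), Ideal.span (Set.range x) = I →
    ∃ F : MvPolynomial (Fin i × Fin m) R,
      MvPolynomial.map (Ideal.Quotient.mk 𝔪) F ≠ 0 ∧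
      ∀ c : Fin i × Fin m → R,
        MvPolynomial.eval (fun p => Ideal.Quotient.mk 𝔪 (c p))
          (MvPolynomial.map (Ideal.Quotient.mk 𝔪) F) ≠ 0 →
        P fun j => ∑ l, c (j, l) * x l

/-- A Noetherian local ring is Cohen–Macaulay iff its maximal ideal contains a regular
sequence whose length is the Krull dimension. -/
def IsCMLocalRing (A : Type*) [CommRing A] [IsLocalRing A] : Prop :=
  ∃ rs : List A, (∀ x ∈ rs, x ∈ IsLocalRing.maximalIdeal A) ∧
    RingTheory.Sequence.IsRegular A rs ∧ ((rs.length : ℕ∞) : WithBot ℕ∞) = ringKrullDim A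

universe v

open RingTheory.Sequence IsLocalRing CategoryTheory Abelian Pointwise in
/-- Passing to the quotient by a regular element lowers the length of regular sequences by one. -/
lemma exists_isRegular_quotSMulTop {S : Type*} [CommRing S] [IsNoetherianRing S] [IsLocalRing S]
    {M : Type v} [AddCommGroup M] [Module S M] [Module.Finite S M] [Small.{v} S] {x : S}
    (hx : x ∈ maximalIdeal S) (hreg : IsSMulRegular M x) {n : ℕ}
    (h : ∃ rs : List S, rs.length = n + 1 ∧ (∀ r ∈ rs, r ∈ maximalIdeal S) ∧ IsRegular M rs) :
    ∃ rs : List S, rs.length = n ∧ (∀ r ∈ rs, r ∈ maximalIdeal S) ∧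
      IsRegular (QuotSMulTop x M) rs := by
  have : Nontrivial M := by
    obtain ⟨rs, -, -, h⟩ := h
    exact h.nontrivial
  have : Nontrivial (QuotSMulTop x M) := nontrivial_quotSMulTop_of_mem_maximalIdeal M hx
  have key (L : Type v) [AddCommGroup L] [Module S L] [Module.Finite S L] [Nontrivial L] :
      maximalIdeal S • (⊤ : Submodule S L) < ⊤ :=
    (Submodule.top_ne_ideal_smul_of_le_jacobson_annihilator
      (maximalIdeal_le_jacobson _)).symm.lt_top
  have h1 := ((ModuleCat.exists_isRegular_tfae (maximalIdeal S) (n + 1) (ModuleCat.of S M)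
    (key M)).out 3 1).mp h
  refine ((ModuleCat.exists_isRegular_tfae (maximalIdeal S) n
    (ModuleCat.of S (QuotSMulTop x M)) (key _)).out 1 3).mp fun i hi => ?_
  have zero1 := AddCommGrpCat.isZero_of_iff_subsingleton.mpr (h1 i (by omega))
  have zero2 := AddCommGrpCat.isZero_of_iff_subsingleton.mpr (h1 (i + 1) (by omega))
  exact AddCommGrpCat.subsingleton_of_isZero <| ShortComplex.Exact.isZero_of_both_zeros
    ((Ext.covariant_sequence_exact₃' _
      (IsSMulRegular.smulShortComplex_shortExact (M := ModuleCat.of S M) hreg)) i (i + 1) rfl)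
    (zero1.eq_zero_of_src _) (zero2.eq_zero_of_tgt _)

open RingTheory.Sequence IsLocalRing Pointwise in
/-- The length of a regular sequence is at most the dimension of each associated prime. -/
lemma RingTheory.Sequence.IsRegular.length_le_ringKrullDim_quotient {S : Type*} [CommRing S]
    [IsNoetherianRing S] [IsLocalRing S] {M : Type*} [AddCommGroup M] [Module S M]
    [Module.Finite S M] {rs : List S} (hrs : IsRegular M rs)
    (hmem : ∀ r ∈ rs, r ∈ maximalIdeal S) {p : Ideal S} (hp : IsAssociatedPrime p M) :
    ((rs.length : ℕ∞) : WithBot ℕ∞) ≤ ringKrullDim (S ⧸ p) := by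
  induction rs generalizing M p with
  | nil =>
    have := hp.isPrime
    simpa using ringKrullDim_nonneg_of_nontrivial
  | cons r rs ih =>
    have hprime := hp.isPrime
    obtain ⟨hr, hrs⟩ := (isRegular_cons_iff M r rs).mp hrs
    obtain ⟨-, m, hm⟩ := isAssociatedPrime_iff.mp hp
    have hpm (a : S) : a ∈ p ↔ a • m = 0 := by
      rw [hm, Submodule.mem_colon_singleton, Submodule.mem_bot]
    have hm0 : m ≠ 0 := fun h => hprime.ne_top ((Ideal.eq_top_iff_one _).mpr (by simp [hpm, h]))
    have hrp : r ∉ p := fun h => hm0 (hr (by simpa using (hpm r).mp h))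
    let N : Submodule S M := Submodule.torsionBySet S M p
    have hN : ∃ u ∈ N, u ∉ r • (⊤ : Submodule S M) := by
      by_contra! hcon
      have hle : N ≤ Ideal.span {r} • N := by
        intro u hu
        obtain ⟨v, -, rfl⟩ := (Submodule.mem_smul_pointwise_iff_exists _ _ _).mp (hcon u hu)
        refine Submodule.smul_mem_smul (Ideal.mem_span_singleton_self r) ?_
        rw [Submodule.mem_torsionBySet_iff] at hu ⊢
        exact fun a => hr ((smul_comm r (a : S) v).trans ((hu a).trans (smul_zero r).symm))
      have hbot := Submodule.eq_bot_of_le_smul_of_le_jacobson_bot _ N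
        (IsNoetherian.noetherian N) hle (by
          rw [jacobson_eq_maximalIdeal ⊥ bot_ne_top]
          exact (Ideal.span_singleton_le_iff_mem _).mpr (hmem r (by simp)))
      have hmN : m ∈ N := (Submodule.mem_torsionBySet_iff _ _).mpr fun a => (hpm a).mp a.2
      rw [hbot] at hmN
      exact hm0 (by simpa using hmN)
    obtain ⟨u, huN, hu⟩ := hN
    let u' : QuotSMulTop r M := Submodule.Quotient.mk u
    have hu' : u' ≠ 0 := fun h => hu ((Submodule.Quotient.mk_eq_zero _).mp h)
    obtain ⟨q, hq, hle⟩ := exists_le_isAssociatedPrime_of_isNoetherianRing S u' hu'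
    have hpq : p ≤ q := fun a ha => hle (by
      rw [Submodule.mem_colon_singleton, Submodule.mem_bot, ← Submodule.Quotient.mk_smul,
        (Submodule.mem_torsionBySet_iff _ _).mp huN ⟨a, ha⟩, Submodule.Quotient.mk_zero])
    have hrq : r ∈ q := hle (by
      rw [Submodule.mem_colon_singleton, Submodule.mem_bot, ← Submodule.Quotient.mk_smul,
        Submodule.Quotient.mk_eq_zero]
      exact Submodule.smul_mem_pointwise_smul _ _ _ trivial)
    have h1 := ih hrs (fun a ha => hmem a (by simp [ha])) hq
    have h2 : ringKrullDim (S ⧸ q) + 1 ≤ ringKrullDim (S ⧸ p) :=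
      ringKrullDim_succ_le_of_surjective (Ideal.Quotient.factor hpq)
        (Ideal.Quotient.factor_surjective hpq) (r := Ideal.Quotient.mk p r)
        (mem_nonZeroDivisors_of_ne_zero (by rwa [Ne, Ideal.Quotient.eq_zero_iff_mem]))
        (by simpa [Ideal.Quotient.eq_zero_iff_mem] using hrq)
    refine le_trans ?_ h2
    push_cast [List.length_cons]
    gcongr
    exact_mod_cast h1

open IsLocalRing in
lemma ringKrullDim_quotient_le_card_of_maximalIdeal_le_radical {S : Type*} [CommRing S]
    [IsNoetherianRing S] [IsLocalRing S] {p : Ideal S} [p.IsPrime] {rs : List S}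
    (hmem : ∀ r ∈ rs, r ∈ maximalIdeal S)
    (hrad : maximalIdeal S ≤ (p ⊔ Ideal.ofList rs).radical) :
    ringKrullDim (S ⧸ p) ≤ ((rs.length : ℕ∞) : WithBot ℕ∞) := by
  classical
  have hsurj := Ideal.Quotient.mk_surjective (I := p)
  have := IsLocalRing.of_surjective' (Ideal.Quotient.mk p) hsurj
  have := IsLocalHom.of_surjective (Ideal.Quotient.mk p) hsurj
  let s : Finset (S ⧸ p) := (rs.map (Ideal.Quotient.mk p)).toFinset
  have hmin : maximalIdeal (S ⧸ p) ∈ (Ideal.span (s : Set (S ⧸ p))).minimalPrimes := by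
    refine ⟨⟨inferInstance, ?_⟩, fun Q ⟨hQ, hle⟩ _ => ?_⟩
    · rw [Ideal.span_le]
      intro a ha
      simp only [s, List.coe_toFinset, List.mem_map, Set.mem_ofPred_eq] at ha
      obtain ⟨b, hb, rfl⟩ := ha
      exact map_nonunit _ b (hmem b hb)
    · have hcomap : (p ⊔ Ideal.ofList rs).radical ≤ Q.comap (Ideal.Quotient.mk p) := by
        refine (Ideal.IsPrime.radical_le_iff inferInstance).mpr (sup_le ?_ (Ideal.span_le.mpr ?_))
        · intro a ha
          rw [Ideal.mem_comap, Ideal.Quotient.eq_zero_iff_mem.mpr ha]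
          exact Q.zero_mem
        · intro a ha
          exact hle (Ideal.subset_span (by
            simpa [s] using ⟨a, ha, rfl⟩))
      intro a ha
      obtain ⟨b, rfl⟩ := hsurj a
      refine hcomap (hrad ?_)
      rw [mem_maximalIdeal, mem_nonunits_iff] at ha ⊢
      exact fun h => ha (h.map _)
  rw [← maximalIdeal_height_eq_ringKrullDim]
  refine WithBot.coe_le_coe.mpr
    ((Ideal.height_le_card_of_mem_minimalPrimes_span_finset hmin).trans ?_)
  exact_mod_cast (List.toFinset_card_le _).trans (by simp)

open RingTheory.Sequence IsLocalRing Pointwise in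
/-- A system of parameters of a Cohen-Macaulay module is a weakly regular sequence. -/
lemma isWeaklyRegular_of_maximalIdeal_le_radical {S : Type*} [CommRing S] [IsNoetherianRing S]
    [IsLocalRing S] {M : Type v} [AddCommGroup M] [Module S M] [Module.Finite S M] [Small.{v} S]
    {xs : List S} (hmem : ∀ r ∈ xs, r ∈ maximalIdeal S)
    (hrad : maximalIdeal S ≤ (Module.annihilator S M ⊔ Ideal.ofList xs).radical)
    (h : ∃ rs : List S, rs.length = xs.length ∧ (∀ r ∈ rs, r ∈ maximalIdeal S) ∧
      IsRegular M rs) :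
    IsWeaklyRegular M xs := by
  induction xs generalizing M with
  | nil => exact .nil S M
  | cons x xs ih =>
    have hxm := hmem x (by simp)
    have hmem' : ∀ r ∈ xs, r ∈ maximalIdeal S := fun r hr => hmem r (by simp [hr])
    have hreg : IsSMulRegular M x := by
      by_contra hx
      have hx' : x ∈ ⋃ p ∈ associatedPrimes S M, (p : Set S) := by
        rw [biUnion_associatedPrimes_eq_zero_divisors]
        simpa [isSMulRegular_iff_right_eq_zero_of_smul, and_comm] using hx
      simp only [Set.mem_iUnion] at hx'
      obtain ⟨p, hp, hxp⟩ := hx'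
      have hprime := IsAssociatedPrime.isPrime hp
      have hann : Module.annihilator S M ≤ p := by
        rw [← Submodule.annihilator_top]
        exact IsAssociatedPrime.annihilator_le hp
      obtain ⟨rs, hlen, hrs, hR⟩ := h
      have h1 := hR.length_le_ringKrullDim_quotient hrs hp
      have h2 : ringKrullDim (S ⧸ p) ≤ _ :=
        ringKrullDim_quotient_le_card_of_maximalIdeal_le_radical hmem' (hrad.trans
          (Ideal.radical_mono (sup_le (le_sup_of_le_left hann)
            (by
              rw [Ideal.ofList_cons]
              exact sup_le_sup_right ((Ideal.span_singleton_le_iff_mem _).mpr hxp) _))))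
      have h3 := h1.trans h2
      rw [hlen, List.length_cons] at h3
      have : xs.length + 1 ≤ xs.length := by exact_mod_cast h3
      omega
    refine .cons hreg (ih hmem' (hrad.trans (Ideal.radical_mono ?_))
      (exists_isRegular_quotSMulTop hxm hreg h))
    rw [Ideal.ofList_cons, ← sup_assoc]
    refine sup_le_sup_right (sup_le ?_ ((Ideal.span_singleton_le_iff_mem _).mpr ?_)) _
    · exact LinearMap.annihilator_le_of_surjective _ (Submodule.mkQ_surjective _)
    · rw [Module.mem_annihilator]
      intro m
      obtain ⟨m, rfl⟩ := Submodule.mkQ_surjective _ m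
      rw [← map_smul, Submodule.mkQ_apply, Submodule.Quotient.mk_eq_zero]
      exact Submodule.smul_mem_pointwise_smul _ _ _ trivial

section BinaryForms

variable {S : Type*} [CommRing S] (x y : S)

/-- The value at `(x, y)` of the binary form of degree `n` with coefficients `a`. -/
def binaryForm (n : ℕ) (a : ℕ → S) : S :=
  ∑ i ∈ Finset.range (n + 1), a i * (x ^ (n - i) * y ^ i)

lemma binaryForm_succ (n : ℕ) (a : ℕ → S) :
    binaryForm x y (n + 1) a = x * binaryForm x y n a + a (n + 1) * y ^ (n + 1) := by
  rw [binaryForm, Finset.sum_range_succ, binaryForm, Finset.mul_sum]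
  congr 1
  · refine Finset.sum_congr rfl fun i hi => ?_
    rw [Nat.succ_sub (Finset.mem_range_succ_iff.mp hi), pow_succ]
    ring
  · simp

lemma binaryForm_succ' (n : ℕ) (a : ℕ → S) :
    binaryForm x y (n + 1) a = a 0 * x ^ (n + 1) + y * binaryForm x y n fun i => a (i + 1) := by
  rw [binaryForm, Finset.sum_range_succ', binaryForm, Finset.mul_sum, add_comm]
  congr 1
  · simp
  · refine Finset.sum_congr rfl fun i _ => ?_
    rw [Nat.add_sub_add_right]
    ring

lemma binaryForm_succ_shift (n : ℕ) (a : ℕ → S) :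
    binaryForm x y (n + 1) (fun i => Nat.casesOn i 0 a) = y * binaryForm x y n a := by
  simp [binaryForm_succ']

lemma binaryForm_add (n : ℕ) (a b : ℕ → S) :
    binaryForm x y n (a + b) = binaryForm x y n a + binaryForm x y n b := by
  simp [binaryForm, add_mul, Finset.sum_add_distrib]

lemma binaryForm_sub (n : ℕ) (a b : ℕ → S) :
    binaryForm x y n (a - b) = binaryForm x y n a - binaryForm x y n b := by
  simp [binaryForm, sub_mul, Finset.sum_sub_distrib]

lemma binaryForm_smul (n : ℕ) (c : S) (a : ℕ → S) :
    binaryForm x y n (c • a) = c * binaryForm x y n a := by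
  simp [binaryForm, Finset.mul_sum, mul_assoc]

lemma binaryForm_congr (n : ℕ) {a b : ℕ → S} (h : ∀ i ≤ n, a i = b i) :
    binaryForm x y n a = binaryForm x y n b :=
  Finset.sum_congr rfl fun i hi => by rw [h i (Finset.mem_range_succ_iff.mp hi)]

lemma binaryForm_mem_mul_pow (n : ℕ) {J : Ideal S} {a : ℕ → S} (ha : ∀ i ≤ n, a i ∈ J) :
    binaryForm x y n a ∈ J * Ideal.span {x, y} ^ n := by
  refine Ideal.sum_mem _ fun i hi => ?_
  have hi := Finset.mem_range_succ_iff.mp hi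
  refine Ideal.mul_mem_mul (ha i hi) ?_
  have h := Ideal.mul_mem_mul
    (Ideal.pow_mem_pow (Ideal.subset_span (show x ∈ ({x, y} : Set S) by simp)) (n - i))
    (Ideal.pow_mem_pow (Ideal.subset_span (show y ∈ ({x, y} : Set S) by simp)) i)
  rwa [← pow_add, Nat.sub_add_cancel hi] at h

lemma binaryForm_mem_pow (n : ℕ) (a : ℕ → S) :
    binaryForm x y n a ∈ Ideal.span {x, y} ^ n := by
  simpa using binaryForm_mem_mul_pow x y n (J := ⊤) (a := a) (by simp)

lemma exists_eq_binaryForm_of_mem_mul_pow (n : ℕ) {J : Ideal S} {s : S}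
    (hs : s ∈ J * Ideal.span {x, y} ^ n) :
    ∃ a : ℕ → S, (∀ i, a i ∈ J) ∧ s = binaryForm x y n a := by
  induction n generalizing s with
  | zero => exact ⟨fun _ => s, fun _ => by simpa using hs, by simp [binaryForm]⟩
  | succ n ih =>
    rw [pow_succ, ← mul_assoc, Ideal.span_insert, Ideal.mul_sup, Submodule.mem_sup] at hs
    obtain ⟨u, hu, v, hv, rfl⟩ := hs
    obtain ⟨u₁, hu₁, rfl⟩ := Ideal.mem_mul_span_singleton.mp hu
    obtain ⟨v₁, hv₁, rfl⟩ := Ideal.mem_mul_span_singleton.mp hv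
    rw [← Ideal.span_insert] at hu₁ hv₁
    obtain ⟨a, ha, rfl⟩ := ih hu₁
    obtain ⟨b, hb, rfl⟩ := ih hv₁
    let a' : ℕ → S := fun i => if i ≤ n then a i else 0
    let b' : ℕ → S := fun i => Nat.casesOn i 0 b
    refine ⟨a' + b', fun i => J.add_mem ?_ ?_, ?_⟩
    · by_cases hi : i ≤ n <;> simp [a', hi, ha]
    · cases i <;> simp [b', hb]
    · rw [binaryForm_add, binaryForm_succ x y n a', binaryForm_succ_shift x y n b,
        binaryForm_congr x y n (a := a') (b := a) (fun i hi => by simp [a', hi])]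
      simp [a', mul_comm]

lemma exists_eq_binaryForm_of_mem_pow (n : ℕ) {s : S} (hs : s ∈ Ideal.span {x, y} ^ n) :
    ∃ a : ℕ → S, s = binaryForm x y n a := by
  obtain ⟨a, -, h⟩ := exists_eq_binaryForm_of_mem_mul_pow x y n (J := ⊤) (by simpa using hs)
  exact ⟨a, h⟩

lemma sq_mul_mem_pow {n : ℕ} {s : S} (hs : s ∈ Ideal.span {x, y} ^ n) :
    x ^ 2 * s ∈ Ideal.span {x, y} ^ (n + 2) := by
  rw [add_comm, pow_add]
  exact Ideal.mul_mem_mul (Ideal.pow_mem_pow (Ideal.subset_span (by simp)) 2) hs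

variable {x y} (hx : ∀ a, x * a = 0 → a = 0)
  (hy : ∀ a, y * a ∈ Ideal.span {x} → a ∈ Ideal.span {x})
include hx hy

lemma coeff_mem_of_binaryForm_eq_zero (n : ℕ) {a : ℕ → S} (h : binaryForm x y n a = 0) :
    ∀ i ≤ n, a i ∈ Ideal.span {x, y} := by
  induction n generalizing a with
  | zero =>
    intro i hi
    obtain rfl := Nat.le_zero.mp hi
    have : a 0 = 0 := by simpa [binaryForm] using h
    simp [this]
  | succ n ih =>
    rw [binaryForm_succ] at h
    have hpow : ∀ k : ℕ, ∀ c, y ^ k * c ∈ Ideal.span {x} → c ∈ Ideal.span {x} := by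
      intro k
      induction k with
      | zero => simp
      | succ k ihk => exact fun c hc => ihk c (hy _ (by rwa [← mul_assoc, ← pow_succ']))
    have hlast : a (n + 1) ∈ Ideal.span {x} := hpow (n + 1) _ (by
      rw [Ideal.mem_span_singleton]
      exact ⟨-binaryForm x y n a, by linear_combination h⟩)
    obtain ⟨b, hb⟩ := Ideal.mem_span_singleton.mp hlast
    let c : ℕ → S := fun i => if i = n then b * y else 0
    have hc : binaryForm x y n c = b * y ^ (n + 1) := by
      rw [binaryForm, Finset.sum_range_succ, Finset.sum_eq_zero fun i hi => by
        simp [c, (Finset.mem_range.mp hi).ne]]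
      simp [c]
      ring
    have key := ih (a := a + c) (hx _ (by
      rw [binaryForm_add, hc]
      linear_combination h - y ^ (n + 1) * hb))
    intro i hi
    rcases hi.lt_or_eq with hi | rfl
    · have hi := Nat.lt_succ_iff.mp hi
      refine (Ideal.add_mem_iff_left _ ?_).mp (key i hi)
      by_cases hin : i = n
      · simpa [c, hin] using Ideal.mul_mem_left _ b (Ideal.subset_span (by simp))
      · simp [c, hin]
    · exact Ideal.span_mono (by simp) hlast

lemma coeff_mem_of_binaryForm_mem_pow_succ (n : ℕ) {a : ℕ → S}
    (h : binaryForm x y n a ∈ Ideal.span {x, y} ^ (n + 1)) :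
    ∀ i ≤ n, a i ∈ Ideal.span {x, y} := by
  rw [pow_succ'] at h
  obtain ⟨b, hb, hab⟩ := exists_eq_binaryForm_of_mem_mul_pow x y n h
  intro i hi
  have := coeff_mem_of_binaryForm_eq_zero hx hy n (a := a - b)
    (by rw [binaryForm_sub, hab, sub_self]) i hi
  simpa using Ideal.add_mem _ this (hb i)

variable {z : S} (hz : ∀ a, z * a ∈ Ideal.span {x, y} → a ∈ Ideal.span {x, y})

include hz

lemma mem_pow_of_mul_mem_pow_succ {n : ℕ} {s : S}
    (h : (x ^ 2 - y * z) * s ∈ Ideal.span {x, y} ^ (n + 1)) : s ∈ Ideal.span {x, y} ^ n := by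
  suffices ∀ j ≤ n, s ∈ Ideal.span {x, y} ^ j from this n le_rfl
  intro j
  induction j with
  | zero => simp
  | succ j ih =>
    intro hj
    have hs := ih (by omega)
    have h1 : y * z * s ∈ Ideal.span {x, y} ^ (j + 2) := by
      have := Ideal.sub_mem _ (sq_mul_mem_pow x y hs)
        (Ideal.pow_le_pow_right (show j + 2 ≤ n + 1 by omega) h)
      convert this using 1
      ring
    obtain ⟨a, rfl⟩ := exists_eq_binaryForm_of_mem_pow x y j hs
    have h2 := coeff_mem_of_binaryForm_mem_pow_succ hx hy (j + 1)
      (a := fun i => Nat.casesOn i 0 (z • a)) (by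
        rwa [binaryForm_succ_shift, binaryForm_smul, ← mul_assoc])
    rw [pow_succ']
    exact binaryForm_mem_mul_pow x y j fun i hi => hz _ (by simpa using h2 (i + 1) (by omega))

/-- The structure of the degree `m + 1` part of the associated graded ring of `(x, y)` modulo
`x ^ 2 - y * z`. -/
lemma binaryForm_mem_pow_sup_span_iff (m : ℕ) (a : ℕ → S) :
    binaryForm x y (m + 1) a ∈ Ideal.span {x, y} ^ (m + 2) ⊔ Ideal.span {x ^ 2 - y * z} ↔
      a 0 ∈ Ideal.span {x, y} ∧ ∀ i ≤ m, a (i + 1) ∈ Ideal.span {x, y} ⊔ Ideal.span {z} := by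
  constructor
  · intro h
    obtain ⟨k, hk, l, hl, hkl⟩ := Submodule.mem_sup.mp h
    obtain ⟨s, rfl⟩ := Ideal.mem_span_singleton.mp hl
    have hs : s ∈ Ideal.span {x, y} ^ m := mem_pow_of_mul_mem_pow_succ hx hy hz (by
      rw [eq_sub_of_add_eq' hkl]
      exact Ideal.sub_mem _ (binaryForm_mem_pow x y _ a)
        (Ideal.pow_le_pow_right (by omega) hk))
    have hs2 := sq_mul_mem_pow x y hs
    obtain ⟨b, rfl⟩ := exists_eq_binaryForm_of_mem_pow x y m hs
    have key := coeff_mem_of_binaryForm_mem_pow_succ hx hy (m + 1)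
      (a := a + fun i => Nat.casesOn i 0 (z • b)) (by
        rw [binaryForm_add, binaryForm_succ_shift, binaryForm_smul]
        convert Ideal.add_mem _ hk hs2 using 1
        linear_combination -hkl)
    refine ⟨by simpa using key 0 (by omega), fun i hi => ?_⟩
    have h1 := Ideal.sub_mem _ (Ideal.mem_sup_left (key (i + 1) (by omega)))
      (Ideal.mem_sup_right (Ideal.mul_mem_right (b i) _ (Ideal.mem_span_singleton_self z)))
    simpa using h1
  · rintro ⟨h0, h⟩
    rw [binaryForm_succ']
    refine Ideal.add_mem _ (Ideal.mem_sup_left ?_) ?_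
    · rw [pow_succ']
      exact Ideal.mul_mem_mul h0 (Ideal.pow_mem_pow (Ideal.subset_span (by simp)) _)
    · have h1 := binaryForm_mem_mul_pow x y m h
      rw [Ideal.sup_mul] at h1
      obtain ⟨u, hu, v, hv, huv⟩ := Submodule.mem_sup.mp h1
      obtain ⟨w, hw, rfl⟩ := Ideal.mem_span_singleton_mul.mp hv
      rw [← huv]
      have : y * (u + z * w) = (y * u + x ^ 2 * w) - (x ^ 2 - y * z) * w := by ring
      rw [this]
      refine Ideal.sub_mem _ (Ideal.mem_sup_left (Ideal.add_mem _ ?_ (sq_mul_mem_pow x y hw)))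
        (Ideal.mem_sup_right (Ideal.mul_mem_right _ _ (Ideal.mem_span_singleton_self _)))
      rw [← pow_succ'] at hu
      rw [pow_succ' _ (m + 1)]
      exact Ideal.mul_mem_mul (Ideal.subset_span (by simp)) hu

end BinaryForms

lemma mem_H0_iff {R : Type*} [CommRing R] {I : Ideal R} {N : Type*} [AddCommGroup N]
    [Module R N] {v : N} : v ∈ H0 I N ↔ ∃ n : ℕ, ∀ a ∈ I ^ n, a • v = 0 := by
  rw [H0, Submodule.mem_iSup_of_directed]
  · simp [Submodule.mem_torsionBySet_iff]
  · refine Monotone.directed_le fun m n hmn => ?_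
    exact Submodule.torsionBySet_le_torsionBySet_of_subset (Ideal.pow_le_pow_right hmn)

lemma mem_map_mk_pow_smul_top_iff {S : Type*} [CommRing S] {J K : Ideal S} {n : ℕ} {s : S} :
    Ideal.Quotient.mk J s ∈ (K.map (Ideal.Quotient.mk J) ^ n • ⊤ : Submodule (S ⧸ J) (S ⧸ J)) ↔
      s ∈ K ^ n ⊔ J := by
  rw [smul_eq_mul, Ideal.mul_top, ← Ideal.map_pow, ← Ideal.mem_comap,
    Ideal.comap_map_of_surjective' _ Ideal.Quotient.mk_surjective, Ideal.mk_ker]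

/-- The image of `s` in `R / Kⁿ⁺¹R`, where `R = S / J`. -/
def mkPow {S : Type*} [CommRing S] (J K : Ideal S) (n : ℕ) :
    S →ₗ[S] (S ⧸ J) ⧸ (K.map (Ideal.Quotient.mk J) ^ (n + 1) • ⊤ : Submodule (S ⧸ J) (S ⧸ J)) :=
  (Submodule.mkQ _).restrictScalars S ∘ₗ J.mkQ

lemma mkPow_eq_zero_iff {S : Type*} [CommRing S] {J K : Ideal S} {n : ℕ} {s : S} :
    mkPow J K n s = 0 ↔ s ∈ K ^ (n + 1) ⊔ J :=
  (Submodule.Quotient.mk_eq_zero _).trans mem_map_mk_pow_smul_top_iff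

lemma mk_smul_mkPow {S : Type*} [CommRing S] (J K : Ideal S) (n : ℕ) (r s : S) :
    Ideal.Quotient.mk J r • mkPow J K n s = mkPow J K n (r * s) := rfl

lemma mem_gradedPiece_iff {S : Type*} [CommRing S] {J K : Ideal S} {n : ℕ}
    {v : (S ⧸ J) ⧸ (K.map (Ideal.Quotient.mk J) ^ (n + 1) • ⊤ : Submodule (S ⧸ J) (S ⧸ J))} :
    v ∈ gradedPiece (K.map (Ideal.Quotient.mk J)) (M := S ⧸ J) n ↔
      ∃ s ∈ K ^ n, mkPow J K n s = v := by
  rw [gradedPiece, Submodule.mem_map]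
  constructor
  · rintro ⟨r, hr, rfl⟩
    rw [smul_eq_mul, Ideal.mul_top, ← Ideal.map_pow,
      Ideal.mem_map_iff_of_surjective _ Ideal.Quotient.mk_surjective] at hr
    obtain ⟨s, hs, rfl⟩ := hr
    exact ⟨s, hs, rfl⟩
  · rintro ⟨s, hs, rfl⟩
    exact ⟨_, mem_map_mk_pow_smul_top_iff.mpr (Ideal.mem_sup_left hs), rfl⟩

/-- The binary form `y * ∑ aᵢ x ^ (m - i) y ^ i`, as a linear function of its coefficients. -/
def mulBinaryForm {S : Type*} [CommRing S] (x y : S) (m : ℕ) : (Fin (m + 1) → S) →ₗ[S] S where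
  toFun a := y * ∑ i, a i * (x ^ (m - i) * y ^ (i : ℕ))
  map_add' a b := by simp [add_mul, mul_add, Finset.sum_add_distrib]
  map_smul' c a := by
    simp only [Pi.smul_apply, smul_eq_mul, RingHom.id_apply, Finset.mul_sum]
    exact Finset.sum_congr rfl fun i _ => by ring

lemma mulBinaryForm_apply {S : Type*} [CommRing S] (x y : S) (m : ℕ) (a : ℕ → S) :
    mulBinaryForm x y m (fun i : Fin (m + 1) => a i) = y * binaryForm x y m a := by
  simp only [mulBinaryForm, binaryForm, LinearMap.coe_mk, AddHom.coe_mk]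
  rw [Finset.sum_range]

lemma mLength_eq_mLength_quotient_ker {S R F Q : Type*} [CommRing S] [CommRing R] [Algebra S R]
    [AddCommGroup F] [Module S F] [AddCommGroup Q] [Module S Q] [Module R Q] [IsScalarTower S R Q]
    (hSR : Function.Surjective (algebraMap S R)) {G : Submodule R Q} (T : Submodule R G)
    (f : F →ₗ[S] Q) (hf : ∀ a, ∃ v ∈ T, (v : Q) = f a) (hT : ∀ v ∈ T, ∃ a, f a = v) :
    mLength R T = mLength S (F ⧸ LinearMap.ker f) := by
  let g : T →ₗ[S] Q := (G.subtype ∘ₗ T.subtype).restrictScalars S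
  have hg : Function.Injective g := Subtype.val_injective.comp Subtype.val_injective
  have hrange : LinearMap.range g = LinearMap.range f := by
    ext q
    constructor
    · rintro ⟨v, rfl⟩
      exact hT v v.2
    · rintro ⟨a, rfl⟩
      obtain ⟨v, hv, hva⟩ := hf a
      exact ⟨⟨v, hv⟩, hva⟩
  rw [mLength, mLength, ← Module.length_eq_height, ← Module.length_eq_height,
    ← Module.length_eq_of_surjective hSR]
  exact (LinearEquiv.ofInjective g hg ≪≫ₗ LinearEquiv.ofEq _ _ hrange ≪≫ₗ
    f.quotKerEquivRange.symm).length_eq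

section Length

variable {S : Type*} [CommRing S] {x y z : S} (hx : ∀ a, x * a = 0 → a = 0)
  (hy : ∀ a, y * a ∈ Ideal.span {x} → a ∈ Ideal.span {x})
  (hz : ∀ a, z * a ∈ Ideal.span {x, y} → a ∈ Ideal.span {x, y})
include hx hy hz

lemma mkPow_mulBinaryForm_eq_zero_iff (m : ℕ) (a : Fin (m + 1) → S) :
    mkPow (Ideal.span {x ^ 2 - y * z}) (Ideal.span {x, y}) (m + 1) (mulBinaryForm x y m a) = 0 ↔
      ∀ i, a i ∈ Ideal.span {x, y} ⊔ Ideal.span {z} := by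
  obtain ⟨b, rfl⟩ : ∃ b : ℕ → S, a = fun i : Fin (m + 1) => b i :=
    ⟨fun i => if h : i < m + 1 then a ⟨i, h⟩ else 0, by ext i; simp [i.2]⟩
  rw [mkPow_eq_zero_iff, mulBinaryForm_apply, ← binaryForm_succ_shift,
    binaryForm_mem_pow_sup_span_iff hx hy hz]
  exact ⟨fun h i => h.2 i (Nat.lt_succ_iff.mp i.2),
    fun h => ⟨zero_mem _, fun i hi => h ⟨i, Nat.lt_succ_iff.mpr hi⟩⟩⟩

/-- The torsion submodule of the degree `m + 1` part of the associated graded ring. -/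
lemma length_H0_gradedPiece {𝔪 : Ideal S} (hzm : z ∈ 𝔪) {N : ℕ}
    (hN : 𝔪 ^ N ≤ Ideal.span {x, y, z}) (m : ℕ) :
    mLength (S ⧸ Ideal.span {x ^ 2 - y * z})
      (H0 (𝔪.map (Ideal.Quotient.mk (Ideal.span {x ^ 2 - y * z})))
        (gradedPiece ((Ideal.span {x, y}).map (Ideal.Quotient.mk (Ideal.span {x ^ 2 - y * z})))
          (M := S ⧸ Ideal.span {x ^ 2 - y * z}) (m + 1))) =
      (m + 1 : ℕ) * mLength S (S ⧸ Ideal.span {x, y, z}) := by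
  have hspan : Ideal.span {x, y, z} = Ideal.span {x, y} ⊔ Ideal.span {z} := by
    rw [← Ideal.span_union]
    congr 1
    ext
    simp
    tauto
  set J := Ideal.span {x ^ 2 - y * z}
  set K := Ideal.span {x, y}
  set L := Ideal.span {x, y, z}
  set T := H0 (𝔪.map (Ideal.Quotient.mk J))
    (gradedPiece (K.map (Ideal.Quotient.mk J)) (M := S ⧸ J) (m + 1))
  have hker (a : Fin (m + 1) → S) : mkPow J K (m + 1) (mulBinaryForm x y m a) = 0 ↔
      ∀ i, a i ∈ L := by
    rw [hspan]
    exact mkPow_mulBinaryForm_eq_zero_iff hx hy hz m a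
  have hgr (a : Fin (m + 1) → S) : mkPow J K (m + 1) (mulBinaryForm x y m a) ∈
      gradedPiece (K.map (Ideal.Quotient.mk J)) (M := S ⧸ J) (m + 1) := by
    refine mem_gradedPiece_iff.mpr ⟨_, ?_, rfl⟩
    rw [pow_succ']
    exact Ideal.mul_mem_mul (Ideal.subset_span (by simp))
      (Ideal.sum_mem _ fun i _ => Ideal.mul_mem_left _ _ (by
        have h := Ideal.mul_mem_mul
          (Ideal.pow_mem_pow (Ideal.subset_span (show x ∈ ({x, y} : Set S) by simp)) (m - i))
          (Ideal.pow_mem_pow (Ideal.subset_span (show y ∈ ({x, y} : Set S) by simp)) i)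
        rwa [← pow_add, Nat.sub_add_cancel (Nat.lt_succ_iff.mp i.2)] at h))
  have htors (a : Fin (m + 1) → S) : (⟨_, hgr a⟩ :
      gradedPiece (K.map (Ideal.Quotient.mk J)) (M := S ⧸ J) (m + 1)) ∈ T := by
    refine mem_H0_iff.mpr ⟨N, fun r hr => ?_⟩
    rw [← Ideal.map_pow, Ideal.mem_map_iff_of_surjective _ Ideal.Quotient.mk_surjective] at hr
    obtain ⟨r, hr, rfl⟩ := hr
    refine Subtype.ext ?_
    change Ideal.Quotient.mk J r • mkPow J K (m + 1) _ = 0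
    rw [mk_smul_mkPow, ← smul_eq_mul, ← map_smul, hker]
    exact fun i => Ideal.mul_mem_right _ _ (hN hr)
  have hker_eq : LinearMap.ker (mkPow J K (m + 1) ∘ₗ mulBinaryForm x y m) =
      Submodule.pi Set.univ fun _ => L := by
    ext a
    rw [LinearMap.mem_ker, LinearMap.comp_apply, hker a]
    simp [Submodule.mem_pi]
  have hsurj (v : gradedPiece (K.map (Ideal.Quotient.mk J)) (M := S ⧸ J) (m + 1)) (hvT : v ∈ T) :
      ∃ a, (mkPow J K (m + 1) ∘ₗ mulBinaryForm x y m) a = v := by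
    obtain ⟨v, hv⟩ := v
    obtain ⟨s, hs, rfl⟩ := mem_gradedPiece_iff.mp hv
    obtain ⟨a, rfl⟩ := exists_eq_binaryForm_of_mem_pow x y (m + 1) hs
    obtain ⟨k, hk⟩ := mem_H0_iff.mp hvT
    have h1 : Ideal.Quotient.mk J (z ^ k) • mkPow J K (m + 1) (binaryForm x y (m + 1) a) = 0 :=
      congrArg Subtype.val (hk (Ideal.Quotient.mk J (z ^ k)) (by
        rw [map_pow]
        exact Ideal.pow_mem_pow (Ideal.mem_map_of_mem _ hzm) k))
    rw [mk_smul_mkPow, ← binaryForm_smul, mkPow_eq_zero_iff,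
      binaryForm_mem_pow_sup_span_iff hx hy hz] at h1
    have hzpow : ∀ k : ℕ, ∀ c, z ^ k * c ∈ K → c ∈ K := by
      intro k
      induction k with
      | zero => simp
      | succ k ih => exact fun c hc => ih c (hz _ (by rwa [← mul_assoc, ← pow_succ']))
    have h0 : a 0 ∈ K := hzpow k _ h1.1
    refine ⟨fun i => a (i + 1), ?_⟩
    rw [LinearMap.comp_apply, mulBinaryForm_apply x y m fun i => a (i + 1), eq_comm, ← sub_eq_zero, ← map_sub,
      mkPow_eq_zero_iff, binaryForm_succ', add_sub_cancel_right, pow_succ']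
    exact Ideal.mem_sup_left (Ideal.mul_mem_mul h0
      (Ideal.pow_mem_pow (Ideal.subset_span (by simp)) _))
  rw [mLength_eq_mLength_quotient_ker Ideal.Quotient.mk_surjective T
      (mkPow J K (m + 1) ∘ₗ mulBinaryForm x y m) (fun a => ⟨_, htors a, rfl⟩) hsurj, hker_eq,
    mLength, mLength, ← Module.length_eq_height, ← Module.length_eq_height,
    (Submodule.quotientPi fun _ => L).length_eq, Module.length_pi_of_fintype]
  simp

end Length

/-- Example 4.1: let `S` be a 3-dimensional Cohen–Macaulay Noetherian local ring with
infinite residue field and `x, y, z` a system of parameters.  With `R = S/(x² − yz)S`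
(a 2-dimensional local ring) and `I = (x, y)R`, one has `j(I) = length_S (S/(x, y, z)S)`. -/
theorem stmt_19 {S : Type*} [CommRing S] [IsNoetherianRing S] [IsLocalRing S]
    (hres : Infinite (IsLocalRing.ResidueField S))
    (hdim : ringKrullDim S = (3 : WithBot ℕ∞)) (hCM : IsCMLocalRing S)
    (x y z : S)
    (hx : x ∈ IsLocalRing.maximalIdeal S) (hy : y ∈ IsLocalRing.maximalIdeal S)
    (hz : z ∈ IsLocalRing.maximalIdeal S)
    (hsop : ∃ n : ℕ, IsLocalRing.maximalIdeal S ^ n ≤ Ideal.span {x, y, z}) :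
    jMult (Ideal.map (Ideal.Quotient.mk (Ideal.span {x ^ 2 - y * z}))
        (IsLocalRing.maximalIdeal S))
      (Ideal.map (Ideal.Quotient.mk (Ideal.span {x ^ 2 - y * z})) (Ideal.span {x, y}))
      (S ⧸ Ideal.span {x ^ 2 - y * z}) 2 =
      ((mLength S (S ⧸ Ideal.span {x, y, z})).toNat : ℝ) := by
  obtain ⟨N, hN⟩ := hsop
  have hofList : Ideal.ofList [x, y, z] = Ideal.span {x, y, z} := by
    rw [Ideal.ofList]
    congr 1
    ext
    simp
  have hreg : RingTheory.Sequence.IsWeaklyRegular S [x, y, z] := by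
    refine isWeaklyRegular_of_maximalIdeal_le_radical ?_ ?_ ?_
    · simp only [List.mem_cons, List.not_mem_nil, or_false, forall_eq_or_imp, forall_eq]
      exact ⟨hx, hy, hz⟩
    · rw [hofList]
      exact fun a ha => ⟨N, Ideal.mem_sup_right (hN (Ideal.pow_mem_pow ha N))⟩
    · obtain ⟨rs, hmem, hrs, hlen⟩ := hCM
      rw [hdim] at hlen
      have hlen' : (rs.length : ℕ∞) = 3 := WithBot.coe_injective hlen
      exact ⟨rs, by exact_mod_cast hlen', hmem, hrs⟩
  have hmod (i : ℕ) (hi : i < 3) (I : Ideal S) (hI : Ideal.ofList ([x, y, z].take i) = I) (a : S)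
      (ha : [x, y, z][i] * a ∈ I) : a ∈ I := by
    subst hI
    have h1 := hreg.regular_mod_prev i hi
    rw [smul_eq_mul, Ideal.mul_top] at h1
    rw [← Ideal.Quotient.eq_zero_iff_mem] at ha ⊢
    exact h1.right_eq_zero_of_smul ha
  have hx' : ∀ a, x * a = 0 → a = 0 := fun a ha => by
    simpa using hmod 0 (by simp) ⊥ (by simp) a (by simpa using ha)
  have hy' : ∀ a, y * a ∈ Ideal.span {x} → a ∈ Ideal.span {x} :=
    hmod 1 (by simp) _ (by simp)
  have hz' : ∀ a, z * a ∈ Ideal.span {x, y} → a ∈ Ideal.span {x, y} :=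
    hmod 2 (by simp) _ (by simp [Ideal.span_insert])
  refine Tendsto.limUnder_eq (tendsto_const_nhds.congr' ?_)
  filter_upwards [eventually_ge_atTop 1] with n hn
  obtain ⟨m, rfl⟩ := Nat.exists_eq_add_of_le' hn
  rw [length_H0_gradedPiece hx' hy' hz' hz hN, ENat.toNat_mul, ENat.toNat_natCast]
  have : ((m + 1 : ℕ) : ℝ) ≠ 0 := by positivity
  push_cast at this ⊢
  simp
  field_simp

end
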